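/- arXiv:1710.05464 — 5 statements merged into one kernel-verified Lean document; each statement's English description precedes it below -/
import Mathlib

section
/- Let n ≥ 1, let g : ℝⁿ → ℝⁿ be continuously differentiable with bounded derivative, let σ > 0, and let h : ℝ × ℝⁿ → ℝⁿ be continuous, σ-periodic in its first argument (h(t+σ,x) = h(t,x) for all t, x), and continuously differentiable in its second argument with bounded derivative. Let x* ∈ ℝⁿ be an equilibrium of the autonomous system, i.e. g(x*) = 0. If every complex eigenvalue λ of the Jacobian matrix Dg(x*) satisfies λ ∉ (2π/σ)·i·ℤ (i.e. σλ is not an integer multiple of 2πi), then there exist a neighborhood U of x* and α > 0 such that for every δ with |δ| < α there exists an initial condition x₀(δ) ∈ U for which the solution x : ℝ → ℝⁿ of ẋ = g(x) + δ·h(t,x), x(0) = x₀(δ), is σ-periodic: x(t+σ) = x(t) for all t ∈ ℝ. -/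
open scoped Real

open scoped Matrix.Norms.Operator in
theorem aux_exp_mulVec {n : ℕ} (B : Matrix (Fin n) (Fin n) ℂ) (w : Fin n → ℂ) (μ : ℂ)
    (hw : B.mulVec w = μ • w) : (NormedSpace.exp B).mulVec w = Complex.exp μ • w := by
  have h1 := NormedSpace.exp_series_hasSum_exp' (𝕂 := ℂ) B
  have h2 := NormedSpace.exp_series_hasSum_exp' (𝕂 := ℂ) μ
  rw [← Complex.exp_eq_exp_ℂ] at h2
  have hpow : ∀ k : ℕ, (B ^ k).mulVec w = μ ^ k • w := by
    intro k
    induction k with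
    | zero => simp
    | succ k ih => rw [pow_succ, ← Matrix.mulVec_mulVec, hw, Matrix.mulVec_smul, ih, smul_smul, pow_succ, mul_comm]
  have h3 := h2.smul_const w
  have h4 := h1.map ((Matrix.mulVecBilin ℂ ℂ).flip w : Matrix (Fin n) (Fin n) ℂ →ₗ[ℂ] (Fin n → ℂ))
    (LinearMap.continuous_of_finiteDimensional _)
  refine h4.unique ?_
  convert h3 using 1
  funext k
  simp [hpow, smul_smul]

theorem aux_eig {n : ℕ} (B : Matrix (Fin n) (Fin n) ℂ) (w : Fin n → ℂ) (hw0 : w ≠ 0)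
    (hw : (NormedSpace.exp B).mulVec w = w) :
    ∃ (μ : ℂ) (v : Fin n → ℂ), v ≠ 0 ∧ B.mulVec v = μ • v ∧ Complex.exp μ = 1 := by
  let V : Submodule ℂ (Fin n → ℂ) := LinearMap.ker ((NormedSpace.exp B).mulVecLin - LinearMap.id)
  have hV : ∀ v, v ∈ V ↔ (NormedSpace.exp B).mulVec v = v := by
    intro v; simp [V, LinearMap.mem_ker, sub_eq_zero]
  have hc : NormedSpace.exp B * B = B * NormedSpace.exp B := (Commute.refl B).exp_left
  have hmap : ∀ v ∈ V, B.mulVecLin v ∈ V := by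
    intro v hv
    rw [hV] at hv ⊢
    rw [Matrix.mulVecLin_apply, Matrix.mulVec_mulVec, hc, ← Matrix.mulVec_mulVec, hv]
  have : Nontrivial V := ⟨⟨⟨w, (hV w).2 hw⟩, 0, fun h => hw0 (congrArg Subtype.val h)⟩⟩
  obtain ⟨μ, hμ⟩ := Module.End.exists_eigenvalue (B.mulVecLin.restrict hmap)
  obtain ⟨v, hv⟩ := hμ.exists_hasEigenvector
  have hv1 : B.mulVec (v : Fin n → ℂ) = μ • (v : Fin n → ℂ) := by
    have := congrArg Subtype.val hv.apply_eq_smul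
    simpa using this
  have hv0 : (v : Fin n → ℂ) ≠ 0 := fun h => hv.2 (Subtype.ext h)
  refine ⟨μ, v, hv0, hv1, ?_⟩
  have h5 := aux_exp_mulVec B v μ hv1
  rw [(hV v).1 v.2] at h5
  have : (Complex.exp μ - 1) • (v : Fin n → ℂ) = 0 := by rw [sub_smul, ← h5]; simp
  rcases smul_eq_zero.1 this with h | h
  · exact sub_eq_zero.1 h
  · exact absurd h hv0

open scoped Matrix.Norms.Operator in
theorem aux_unit {n : ℕ} (σ : ℝ) (hσ : 0 < σ) (A : (Fin n → ℝ) →L[ℝ] (Fin n → ℝ))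
    (heig : ∀ lam : ℂ,
      (∃ v : Fin n → ℂ, v ≠ 0 ∧
        (Matrix.of fun i j => ((A (Pi.single j 1) i : ℝ) : ℂ)).mulVec v
          = lam • v) →
      ∀ k : ℤ, lam ≠ (2 * π / σ) * Complex.I * k) :
    IsUnit (1 - NormedSpace.exp (σ • A)) := by
  let Φ : ((Fin n → ℝ) →L[ℝ] (Fin n → ℝ)) →+* Matrix (Fin n) (Fin n) ℂ :=
    ((algebraMap ℝ ℂ).mapMatrix).comp
      ((LinearMap.toMatrixAlgEquiv' : _ ≃ₐ[ℝ] Matrix (Fin n) (Fin n) ℝ).toRingEquiv.toRingHom.comp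
        ContinuousLinearMap.toLinearMapRingHom)
  have hΦ : ∀ T i j, Φ T i j = ((T (Pi.single j 1) i : ℝ) : ℂ) := by
    intro T i j
    simp [Φ, LinearMap.toMatrixAlgEquiv'_apply]
  have hΦv : ∀ T (v : Fin n → ℝ), (Φ T).mulVec (fun i => (v i : ℂ)) = fun i => ((T v i : ℝ) : ℂ) := by
    intro T v
    funext i
    have h1 : T v = ∑ j, v j • T (Pi.single j 1) := by
      conv_lhs => rw [pi_eq_sum_univ' v]
      simp [map_sum, map_smul]
    rw [h1]
    simp [Matrix.mulVec, dotProduct, hΦ, mul_comm]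
  have hcont : Continuous Φ := by
    let Φl : ((Fin n → ℝ) →L[ℝ] (Fin n → ℝ)) →ₗ[ℝ] Matrix (Fin n) (Fin n) ℂ :=
      { toFun := Φ, map_add' := map_add Φ, map_smul' := by
          intro c T; ext i j; simp [hΦ] }
    exact Φl.continuous_of_finiteDimensional
  let _ : NormedAlgebra ℚ ((Fin n → ℝ) →L[ℝ] (Fin n → ℝ)) := NormedAlgebra.restrictScalars ℚ ℝ _
  have hmap := NormedSpace.map_exp Φ hcont (σ • A)
  have hinj : LinearMap.ker ((1 - NormedSpace.exp (σ • A) : (Fin n → ℝ) →L[ℝ] (Fin n → ℝ)) : (Fin n → ℝ) →ₗ[ℝ] (Fin n → ℝ)) = ⊥ := by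
    rw [LinearMap.ker_eq_bot']
    intro v hv
    by_contra hv0
    have hv' : NormedSpace.exp (σ • A) v = v := by
      have h1 : v - NormedSpace.exp (σ • A) v = 0 := by simpa using hv
      exact (sub_eq_zero.1 h1).symm
    obtain ⟨μ, w, hw0, hw, hμ⟩ := aux_eig (Φ (σ • A)) (fun i => (v i : ℂ))
      (by
        intro h0; apply hv0; funext i
        simpa using congrFun h0 i)
      ((congrArg (fun P : Matrix (Fin n) (Fin n) ℂ => P.mulVec (fun i => (v i : ℂ))) hmap.symm).trans (by
        simp only [hΦv, hv']))
    obtain ⟨k, hk⟩ := Complex.exp_eq_one_iff.1 hμ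
    have hσ' : (σ : ℂ) ≠ 0 := by exact_mod_cast hσ.ne'
    refine heig (μ / σ) ⟨w, hw0, ?_⟩ k ?_
    · have : Φ (σ • A) = (σ : ℂ) • (Matrix.of fun i j => ((A (Pi.single j 1) i : ℝ) : ℂ)) := by
        ext i j; simp [hΦ]
      rw [this, Matrix.smul_mulVec] at hw
      rw [div_eq_inv_mul, mul_smul, ← hw, smul_smul, inv_mul_cancel₀ hσ', one_smul]
    · rw [hk]; field_simp
  obtain ⟨u, hu⟩ := (LinearMap.isUnit_iff_ker_eq_bot _).2 hinj
  refine ⟨⟨1 - NormedSpace.exp (σ • A), LinearMap.toContinuousLinearMap (↑u⁻¹ : (Fin n → ℝ) →ₗ[ℝ] (Fin n → ℝ)), ?_, ?_⟩, rfl⟩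
  · ext1 v
    have := congrArg (fun f : (Fin n → ℝ) →ₗ[ℝ] (Fin n → ℝ) => f v) u.mul_inv
    rw [hu] at this
    simpa using this
  · ext1 v
    have := congrArg (fun f : (Fin n → ℝ) →ₗ[ℝ] (Fin n → ℝ) => f v) u.inv_mul
    rw [hu] at this
    simpa using this

theorem aux_green {E : Type*} [NormedAddCommGroup E] [NormedSpace ℝ E] [CompleteSpace E]
    (σ : ℝ) (A : E →L[ℝ] E) (hu : IsUnit (1 - NormedSpace.exp (σ • A))) :
    ∃ G : ℝ → E →L[ℝ] E, Continuous G ∧ ∀ f : ℝ → E, Continuous f → (∀ t, f (t + σ) = f t) →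
      ∀ t, HasDerivAt (fun t => ∫ u in (0:ℝ)..σ, G u (f (t + u)))
        (A (∫ u in (0:ℝ)..σ, G u (f (t + u))) + f t) t := by
  obtain ⟨U, hU⟩ := hu
  let _ : NormedAlgebra ℚ (E →L[ℝ] E) := NormedAlgebra.restrictScalars ℚ ℝ _
  let e : ℝ → E →L[ℝ] E := fun t => NormedSpace.exp (t • A)
  have he : ∀ t, HasDerivAt e (A * e t) t := fun t => hasDerivAt_exp_smul_const' A t
  have hec : Continuous e := continuous_iff_continuousAt.2 fun t => (he t).continuousAt
  have hadd : ∀ s t, e (s + t) = e s * e t := by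
    intro s t
    simp only [e, add_smul]
    exact NormedSpace.exp_add_of_commute (((Commute.refl A).smul_left s).smul_right t)
  have he0 : e 0 = 1 := by simp [e]
  have hcU : ∀ t, Commute (e t) (U : E →L[ℝ] E) := by
    intro t
    rw [hU]
    refine (Commute.one_right _).sub_right ?_
    exact (((Commute.refl A).smul_left t).smul_right σ).exp
  have hcK : ∀ t, Commute (e t) (↑U⁻¹ : E →L[ℝ] E) := fun t => (hcU t).units_inv_right
  let K : E →L[ℝ] E := ↑U⁻¹
  refine ⟨fun u => K * e (σ - u), by fun_prop, ?_⟩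
  intro f hf hper t
  let q : ℝ → E := fun s => e (-s) (f s)
  have hq : Continuous q := by
    exact (hec.comp continuous_neg).clm_apply hf
  have hy : ∀ t, ∫ u in (0:ℝ)..σ, (K * e (σ - u)) (f (t + u))
      = (e (t + σ) * K) ((∫ s in (0:ℝ)..(t + σ), q s) - ∫ s in (0:ℝ)..t, q s) := by
    intro t
    rw [intervalIntegral.integral_interval_sub_left (hq.intervalIntegrable _ _) (hq.intervalIntegrable _ _)]
    rw [← ContinuousLinearMap.intervalIntegral_comp_comm _ (hq.intervalIntegrable _ _)]
    have := intervalIntegral.integral_comp_add_left (a := 0) (b := σ) (fun s => (e (t + σ) * K) (q s)) t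
    rw [add_zero] at this
    rw [← this]
    congr 1
    funext u
    have h1 : (e (t + σ) * K) * e (-(t + u)) = K * e (σ - u) := by
      rw [(hcK (t+σ)).eq, mul_assoc, ← hadd]
      congr 2; ring
    rw [← h1]; rfl
  have hI : ∀ t, HasDerivAt (fun t => ∫ s in (0:ℝ)..t, q s) (q t) t := fun t =>
    intervalIntegral.integral_hasDerivAt_right (hq.intervalIntegrable _ _)
      (hq.stronglyMeasurableAtFilter _ _) hq.continuousAt
  have hI2 : HasDerivAt (fun t => ∫ s in (0:ℝ)..(t + σ), q s) (q (t + σ)) t := by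
    simpa using (hI (t + σ)).comp_add_const t σ
  have he2 : HasDerivAt (fun t => e (t + σ) * K) (A * e (t + σ) * K) t :=
    ((he (t + σ)).comp_add_const t σ).mul_const K
  have hmain := he2.clm_apply (hI2.sub (hI t))
  simp only [hy]
  refine hmain.congr_deriv ?_
  congr 1
  simp only [q, hper]
  rw [← sub_eq_zero]
  have h2 : (e (t + σ) * K) * (e (-(t + σ)) - e (-t)) = 1 := by
    rw [(hcK (t+σ)).eq, mul_assoc, mul_sub, ← hadd, ← hadd]
    have : t + σ + -(t + σ) = 0 := by ring
    rw [this, he0, show t + σ + -t = σ by ring, show (1 - e σ : E →L[ℝ] E) = U from hU.symm]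
    exact U.inv_mul
  have h3 := congrArg (fun T : E →L[ℝ] E => T (f t)) h2
  simp only [sub_eq_zero]
  simpa using h3

theorem aux_fix {n : ℕ} (σ : ℝ) (hσ : 0 < σ)
    (g : (Fin n → ℝ) → (Fin n → ℝ)) (hg : ContDiff ℝ 1 g)
    (h : ℝ × (Fin n → ℝ) → (Fin n → ℝ))
    (hh_cont : Continuous h)
    (hh_per : ∀ t x, h (t + σ, x) = h (t, x))
    (C : ℝ) (hC0 : 0 ≤ C) (hC : ∀ t x y, ‖h (t, x) - h (t, y)‖ ≤ C * ‖x - y‖)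
    (xstar : Fin n → ℝ) (hxstar : g xstar = 0)
    (hu : IsUnit (1 - NormedSpace.exp (σ • fderiv ℝ g xstar))) :
    ∃ α > (0:ℝ), ∀ δ : ℝ, |δ| < α →
      ∃ x : ℝ → (Fin n → ℝ),
        (∀ t, HasDerivAt x (g (x t) + δ • h (t, x t)) t) ∧
        (∀ t, x (t + σ) = x t) := by
  set A := fderiv ℝ g xstar with hA
  obtain ⟨G, hGc, hG⟩ := aux_green σ A hu
  obtain ⟨M0, hM0⟩ := (isCompact_Icc (a := (0:ℝ)) (b := σ)).exists_bound_of_continuousOn hGc.continuousOn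
  set M : ℝ := (|M0| + 1) * σ with hM
  have hMpos : 0 < M := by positivity
  have hbd : ∀ (f : ℝ → (Fin n → ℝ)) (b : ℝ), (∀ t, ‖f t‖ ≤ b) →
      ∀ t, ‖∫ u in (0:ℝ)..σ, G u (f (t + u))‖ ≤ M * b := by
    intro f b hf t
    have hb : 0 ≤ b := (norm_nonneg _).trans (hf 0)
    have := intervalIntegral.norm_integral_le_of_norm_le_const (a := 0) (b := σ)
      (f := fun u => G u (f (t + u))) (C := (|M0| + 1) * b) ?_
    · refine this.trans (le_of_eq ?_)
      rw [sub_zero, abs_of_pos hσ, hM]; ring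
    · intro u hu
      rw [Set.uIoc_of_le hσ.le] at hu
      refine ((G u).le_opNorm _).trans ?_
      have h1 : ‖G u‖ ≤ |M0| + 1 := (hM0 u ⟨hu.1.le, hu.2⟩).trans (by linarith [le_abs_self M0])
      exact mul_le_mul h1 (hf _) (norm_nonneg _) (by positivity)
  obtain ⟨H0, hH0⟩ := (isCompact_Icc (a := (0:ℝ)) (b := σ)).exists_bound_of_continuousOn
    (f := fun t => h (t, xstar)) (by fun_prop)
  have hH : ∀ t, ‖h (t, xstar)‖ ≤ |H0| := by
    intro t
    have hp : Function.Periodic (fun t => h (t, xstar)) σ := fun t => hh_per t xstar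
    obtain ⟨s, hs, hts⟩ := hp.exists_mem_Ico₀ hσ t
    rw [show h (t, xstar) = h (s, xstar) from hts]
    exact (hH0 s ⟨hs.1, hs.2.le⟩).trans (le_abs_self _)
  have hstrict : HasStrictFDerivAt g A xstar := hg.contDiffAt.hasStrictFDerivAt (by norm_num)
  set c : ℝ := 1 / (4 * M) with hc
  have hcpos : 0 < c := by positivity
  have hev := hstrict.isLittleO.def hcpos
  rw [Metric.eventually_nhds_iff] at hev
  obtain ⟨ε, hε, hev⟩ := hev
  set r : ℝ := ε / 2 with hr
  have hrpos : 0 < r := by positivity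
  let R : (Fin n → ℝ) → (Fin n → ℝ) := fun y => g (xstar + y) - A y
  have hR : ∀ y z, ‖y‖ ≤ r → ‖z‖ ≤ r → ‖R y - R z‖ ≤ c * ‖y - z‖ := by
    intro y z hy hz
    have := @hev (xstar + y, xstar + z) (by
      rw [Prod.dist_eq]
      have e1 : dist (xstar + y) xstar = ‖y‖ := by simp [dist_eq_norm]
      have e2 : dist (xstar + z) xstar = ‖z‖ := by simp [dist_eq_norm]
      refine max_lt (e1.trans_lt ?_) (e2.trans_lt ?_) <;> linarith)
    simp only [add_sub_add_left_eq_sub, map_sub] at this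
    have e3 : R y - R z = g (xstar + y) - g (xstar + z) - (A y - A z) := by
      simp only [R]; abel
    rw [e3]
    exact this
  have hR0 : R 0 = 0 := by simp [R, hxstar]
  have hRc : Continuous R := by
    have := hg.continuous
    fun_prop
  set α : ℝ := min (1 / (4 * M * (C + 1))) (r / (4 * M * (|H0| + 1))) with hα
  have hαpos : 0 < α := by positivity
  refine ⟨α, hαpos, ?_⟩
  intro δ hδ
  have hδ1 : M * (|δ| * C) ≤ 1 / 4 := by
    have h1 : |δ| ≤ 1 / (4 * M * (C + 1)) := hδ.le.trans (min_le_left _ _)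
    rw [le_div_iff₀ (by positivity)] at h1
    nlinarith [abs_nonneg δ, mul_nonneg (abs_nonneg δ) hMpos.le]
  have hδ2 : M * (|δ| * |H0|) ≤ r / 4 := by
    have h1 : |δ| ≤ r / (4 * M * (|H0| + 1)) := hδ.le.trans (min_le_right _ _)
    rw [le_div_iff₀ (by positivity)] at h1
    nlinarith [abs_nonneg δ, mul_nonneg (abs_nonneg δ) hMpos.le]
  have hMc : M * c = 1 / 4 := by rw [hc]; field_simp
  let F : ℝ → (Fin n → ℝ) → (Fin n → ℝ) := fun t y => R y + δ • h (t, xstar + y)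
  have hFlip : ∀ t y z, ‖y‖ ≤ r → ‖z‖ ≤ r → ‖F t y - F t z‖ ≤ (c + |δ| * C) * ‖y - z‖ := by
    intro t y z hy hz
    have h1 : F t y - F t z = (R y - R z) + δ • (h (t, xstar + y) - h (t, xstar + z)) := by
      simp only [F, smul_sub]; abel
    rw [h1]
    refine (norm_add_le _ _).trans ?_
    rw [norm_smul, Real.norm_eq_abs, add_mul]
    have h2 := hC t (xstar + y) (xstar + z)
    rw [add_sub_add_left_eq_sub] at h2
    have h3 := mul_le_mul_of_nonneg_left h2 (abs_nonneg δ)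
    linarith [hR y z hy hz]
  have hF0 : ∀ t, ‖F t 0‖ ≤ |δ| * |H0| := by
    intro t
    simp only [F, hR0, zero_add, add_zero, norm_smul, Real.norm_eq_abs]
    exact mul_le_mul_of_nonneg_left (hH t) (abs_nonneg δ)
  have hFb : ∀ t y, ‖y‖ ≤ r → ‖F t y‖ ≤ (c + |δ| * C) * r + |δ| * |H0| := by
    intro t y hy
    have h1 := hFlip t y 0 hy (by simpa using hrpos.le)
    rw [sub_zero] at h1
    have h2 : ‖F t y‖ ≤ ‖F t y - F t 0‖ + ‖F t 0‖ := by
      simpa using norm_add_le (F t y - F t 0) (F t 0)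
    have h3 : (c + |δ| * C) * ‖y‖ ≤ (c + |δ| * C) * r :=
      mul_le_mul_of_nonneg_left hy (by positivity)
    linarith [hF0 t]
  let S : Set (BoundedContinuousFunction ℝ (Fin n → ℝ)) :=
    {y | (∀ t, ‖y t‖ ≤ r) ∧ ∀ t, y (t + σ) = y t}
  have hSc : IsClosed S := by
    have : S = (⋂ t, {y | ‖y t‖ ≤ r}) ∩ ⋂ t, {y | y (t + σ) = y t} := by
      ext y; simp [S]
    rw [this]
    refine IsClosed.inter (isClosed_iInter fun t => ?_) (isClosed_iInter fun t => ?_)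
    · exact isClosed_le (continuous_eval_const t).norm continuous_const
    · exact isClosed_eq (continuous_eval_const _)
        (continuous_eval_const _)
  have hFc : ∀ y : S, Continuous fun t => F t (y.1 t) := by
    intro y
    have := y.1.continuous
    simp only [F]
    fun_prop
  have hFp : ∀ y : S, ∀ t, F (t + σ) (y.1 (t + σ)) = F t (y.1 t) := by
    intro y t
    simp only [F, y.2.2 t, hh_per]
  have hD : ∀ y : S, ∀ t, HasDerivAt (fun t => ∫ u in (0:ℝ)..σ, G u (F (t + u) (y.1 (t + u))))
        (A (∫ u in (0:ℝ)..σ, G u (F (t + u) (y.1 (t + u)))) + F t (y.1 t)) t :=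
    fun y t => hG (fun t => F t (y.1 t)) (hFc y) (hFp y) t
  have hT : ∀ y : S, ∃ z : S, ∀ t, z.1 t = ∫ u in (0:ℝ)..σ, G u (F (t + u) (y.1 (t + u))) := by
    intro y
    have hb : ∀ t, ‖∫ u in (0:ℝ)..σ, G u (F (t + u) (y.1 (t + u)))‖ ≤ r := by
      intro t
      refine (hbd (fun t => F t (y.1 t)) _ (fun t => hFb t _ (y.2.1 t)) t).trans ?_
      nlinarith
    refine ⟨⟨BoundedContinuousFunction.ofNormedAddCommGroup _
      (continuous_iff_continuousAt.2 fun t => (hD y t).continuousAt) r hb, hb, ?_⟩, fun t => rfl⟩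
    intro t
    simp only [BoundedContinuousFunction.coe_ofNormedAddCommGroup]
    congr 1
    funext u
    rw [show t + σ + u = (t + u) + σ by ring, hFp y]
  choose T hT using hT
  have : CompleteSpace S := hSc.completeSpace_coe
  have : Nonempty S := ⟨⟨0, by simpa using hrpos.le, by simp⟩⟩
  have hcontr : ContractingWith (1/2) T := by
    refine ⟨by rw [← NNReal.coe_lt_coe]; norm_num, LipschitzWith.of_dist_le_mul fun y z => ?_⟩
    rw [Subtype.dist_eq, Subtype.dist_eq]
    rw [BoundedContinuousFunction.dist_le (by positivity)]
    intro t
    rw [hT, hT, dist_eq_norm, ← intervalIntegral.integral_sub]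
    · simp only [← map_sub]
      refine (hbd (fun t => F t (y.1 t) - F t (z.1 t)) ((c + |δ| * C) * dist y.1 z.1) ?_ t).trans ?_
      · intro t
        refine (hFlip t _ _ (y.2.1 t) (z.2.1 t)).trans ?_
        refine mul_le_mul_of_nonneg_left ?_ (by positivity)
        rw [← dist_eq_norm]
        exact BoundedContinuousFunction.dist_coe_le_dist t
      · rw [← mul_assoc]
        refine mul_le_mul_of_nonneg_right ?_ dist_nonneg
        push_cast
        linarith
    · exact (hGc.clm_apply ((hFc y).comp (continuous_const.add continuous_id))).intervalIntegrable _ _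
    · exact (hGc.clm_apply ((hFc z).comp (continuous_const.add continuous_id))).intervalIntegrable _ _
  obtain ⟨y, hy⟩ : ∃ y, T y = y := ⟨_, hcontr.fixedPoint_isFixedPt⟩
  have hyt : ∀ t, y.1 t = ∫ u in (0:ℝ)..σ, G u (F (t + u) (y.1 (t + u))) := by
    intro t
    conv_lhs => rw [← hy]
    exact hT y t
  refine ⟨fun t => xstar + y.1 t, ?_, fun t => by simp only [y.2.2 t]⟩
  intro t
  have h1 := hD y t
  simp only [← hyt] at h1
  refine (h1.const_add xstar).congr_deriv ?_
  simp only [F, R]; abel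

/-- Existence of a σ-periodic solution of the perturbed system
`ẋ = g(x) + δ h(t,x)` near a hyperbolic-enough equilibrium `x*`. -/
theorem periodic_solution_exists_near_equilibrium
    (n : ℕ) (hn : 1 ≤ n) (σ : ℝ) (hσ : 0 < σ)
    (g : (Fin n → ℝ) → (Fin n → ℝ))
    (hg : ContDiff ℝ 1 g)
    (hg_bd : ∃ C, ∀ x, ‖fderiv ℝ g x‖ ≤ C)
    (h : ℝ × (Fin n → ℝ) → (Fin n → ℝ))
    (hh_cont : Continuous h)
    (hh_per : ∀ t x, h (t + σ, x) = h (t, x))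
    (hh_diff : ∀ t, ContDiff ℝ 1 fun x => h (t, x))
    (hh_bd : ∃ C, ∀ t x, ‖fderiv ℝ (fun x => h (t, x)) x‖ ≤ C)
    (xstar : Fin n → ℝ) (hxstar : g xstar = 0)
    (heig : ∀ lam : ℂ,
      (∃ v : Fin n → ℂ, v ≠ 0 ∧
        (Matrix.of fun i j => ((fderiv ℝ g xstar (Pi.single j 1) i : ℝ) : ℂ)).mulVec v
          = lam • v) →
      ∀ k : ℤ, lam ≠ (2 * π / σ) * Complex.I * k) :
    ∃ U ∈ nhds xstar, ∃ α > (0:ℝ), ∀ δ : ℝ, |δ| < α →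
      ∃ x₀ ∈ U, ∃ x : ℝ → (Fin n → ℝ),
        x 0 = x₀ ∧
        (∀ t, HasDerivAt x (g (x t) + δ • h (t, x t)) t) ∧
        (∀ t, x (t + σ) = x t) := by
  obtain ⟨C, hC⟩ := hh_bd
  have hLip : ∀ t x y, ‖h (t, x) - h (t, y)‖ ≤ |C| * ‖x - y‖ := by
    intro t x y
    exact Convex.norm_image_sub_le_of_norm_fderiv_le (𝕜 := ℝ) (f := fun x => h (t, x)) (s := Set.univ)
      (fun z _ => ((hh_diff t).differentiable (by norm_num)) z)
      (fun z _ => (hC t z).trans (le_abs_self C)) convex_univ (Set.mem_univ y) (Set.mem_univ x)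
  obtain ⟨α, hα, H⟩ := aux_fix σ hσ g hg h hh_cont hh_per |C| (abs_nonneg C) hLip xstar hxstar
    (aux_unit σ hσ (fderiv ℝ g xstar) heig)
  refine ⟨Set.univ, Filter.univ_mem, α, hα, fun δ hδ => ?_⟩
  obtain ⟨x, hx1, hx2⟩ := H δ hδ
  exact ⟨x 0, Set.mem_univ _, x, rfl, hx1, hx2⟩
end

section
/- Let N, ν, α, γ, μ, κ be positive reals with R₀ := α/((γ+μ)ν) > 1, and define the autonomous IR vector field g : ℝ² → ℝ² by g(I,R) = ( α(N−I−R)·I/(I+νN) − (γ+μ)I , γI − (μ+κ)R ). Then the point EE = ( N(μ+κ)(γ+μ)ν(R₀−1)/((α+μ)(γ+μ+κ)+γκ) , Nγ(γ+μ)ν(R₀−1)/((α+μ)(γ+μ+κ)+γκ) ) is an equilibrium of g (g(EE) = 0), and both coordinates of EE are strictly positive. -/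
/-- When `R₀ = α/((γ+μ)ν) > 1`, the endemic equilibrium EE of the autonomous
IR model is an equilibrium with strictly positive coordinates. -/
theorem ir_endemic_equilibrium
    (N ν α γ μ κ : ℝ) (hN : 0 < N) (hν : 0 < ν) (hα : 0 < α)
    (hγ : 0 < γ) (hμ : 0 < μ) (hκ : 0 < κ)
    (hR0 : 1 < α / ((γ + μ) * ν))
    (g : (Fin 2 → ℝ) → (Fin 2 → ℝ))
    (hg : ∀ x, g x = ![α * (N - x 0 - x 1) * x 0 / (x 0 + ν * N) - (γ + μ) * x 0,
                       γ * x 0 - (μ + κ) * x 1]) :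
    g ![N * (μ + κ) * (γ + μ) * ν * (α / ((γ + μ) * ν) - 1) /
          ((α + μ) * (γ + μ + κ) + γ * κ),
        N * γ * (γ + μ) * ν * (α / ((γ + μ) * ν) - 1) /
          ((α + μ) * (γ + μ + κ) + γ * κ)] = 0 ∧
    0 < N * (μ + κ) * (γ + μ) * ν * (α / ((γ + μ) * ν) - 1) /
          ((α + μ) * (γ + μ + κ) + γ * κ) ∧
    0 < N * γ * (γ + μ) * ν * (α / ((γ + μ) * ν) - 1) /
          ((α + μ) * (γ + μ + κ) + γ * κ) := by
  have hD : 0 < (α + μ) * (γ + μ + κ) + γ * κ := by positivity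
  have hs : 0 < α / ((γ + μ) * ν) - 1 := by linarith
  have hA : 0 < N * (μ + κ) * (γ + μ) * ν * (α / ((γ + μ) * ν) - 1) /
          ((α + μ) * (γ + μ + κ) + γ * κ) := by
    apply div_pos _ hD
    exact mul_pos (by positivity) hs
  have hB : 0 < N * γ * (γ + μ) * ν * (α / ((γ + μ) * ν) - 1) /
          ((α + μ) * (γ + μ + κ) + γ * κ) := by
    apply div_pos _ hD
    exact mul_pos (by positivity) hs
  refine ⟨?_, hA, hB⟩
  have hr : α = (α / ((γ + μ) * ν)) * ((γ + μ) * ν) := by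
    have : γ + μ ≠ 0 := by positivity
    field_simp
  generalize α / ((γ + μ) * ν) = r at *
  generalize hI : N * (μ + κ) * (γ + μ) * ν * (r - 1) /
          ((α + μ) * (γ + μ + κ) + γ * κ) = I at *
  generalize hR : N * γ * (γ + μ) * ν * (r - 1) /
          ((α + μ) * (γ + μ + κ) + γ * κ) = R at *
  rw [div_eq_iff hD.ne'] at hI hR
  have h2 : γ * I - (μ + κ) * R = 0 := by
    apply mul_right_cancel₀ hD.ne'
    linear_combination (-γ) * hI + (μ + κ) * hR
  have h1 : α * (N - I - R) = (γ + μ) * (I + ν * N) := by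
    apply mul_right_cancel₀ hD.ne'
    linear_combination (α + γ + μ) * hI + α * hR + N * ((α + μ) * (γ + μ + κ) + γ * κ) * hr
  have hd : I + ν * N ≠ 0 := by positivity
  rw [hg]
  ext i
  fin_cases i
  · simp only [Matrix.cons_val_zero, Matrix.cons_val_one, Fin.zero_eta, Pi.zero_apply]
    rw [h1]
    field_simp
    ring
  · simpa using h2
end

section
/- Let N, ν, α, γ, μ, κ, σ be positive reals, δ ∈ ℝ, and let p : ℝ → ℝ be a continuous σ-periodic function with β(t) := α + δp(t) ≥ 0 and bounded. Consider the nonautonomous IR system İ = β(t)(N−I−R)·I/(I+νN) − (γ+μ)I, Ṙ = γI − (μ+κ)R. If R₀ := α/((γ+μ)ν) < 1 and additionally the first Floquet exponent α/ν + (δ/(νσ))∫₀^σ p(s)ds − γ − μ is negative (which holds in particular when ∫₀^σ p = 0 and R₀ < 1), then the trivial periodic solution (I,R) ≡ (0,0) is locally asymptotically stable: there exists ε > 0 such that every solution (I,R) with 0 ≤ I(0), 0 ≤ R(0), I(0)+R(0) ≤ N and ‖(I(0),R(0))‖ < ε satisfies (I(t), R(t)) → (0,0) as t → ∞. -/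
lemma ir_compare (f f' A a : ℝ → ℝ) (T : ℝ)
    (hf : ∀ t ≥ T, HasDerivAt f (f' t) t) (hA : ∀ t ≥ T, HasDerivAt A (a t) t)
    (h : ∀ t ≥ T, f' t ≤ a t * f t) : ∀ t ≥ T, f t ≤ f T * Real.exp (A t - A T) := by
  have hd : ∀ t ≥ T, HasDerivAt (fun s => f s * Real.exp (-A s))
      (f' t * Real.exp (-A t) + f t * (Real.exp (-A t) * (-a t))) t :=
    fun t ht => (hf t ht).mul ((hA t ht).neg.exp)
  have hanti : AntitoneOn (fun s => f s * Real.exp (-A s)) (Set.Ici T) := by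
    apply antitoneOn_of_deriv_nonpos (convex_Ici T)
    · exact fun t ht => (hd t ht).continuousAt.continuousWithinAt
    · intro t ht
      rw [interior_Ici] at ht
      exact (hd t (le_of_lt ht)).differentiableAt.differentiableWithinAt
    · intro t ht
      rw [interior_Ici] at ht
      rw [(hd t (le_of_lt ht)).deriv]
      have := h t (le_of_lt ht)
      have := Real.exp_pos (-A t)
      nlinarith
  intro t ht
  have h1 := hanti (Set.mem_Ici.2 le_rfl) (Set.mem_Ici.2 ht) ht
  simp only at h1
  have h2 := mul_le_mul_of_nonneg_right h1 (Real.exp_pos (A t)).le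
  rw [mul_assoc, mul_assoc, ← Real.exp_add, ← Real.exp_add] at h2
  simpa [sub_eq_add_neg, add_comm] using h2

lemma ir_I_nonneg (N ν g : ℝ) (hN : 0 < N) (hν : 0 < ν) (hg : 0 < g) (b I R : ℝ → ℝ)
    (hb : ∀ t, 0 ≤ b t) (B : ℝ) (hB : ∀ t, b t ≤ B)
    (hI : ∀ t ≥ (0:ℝ), HasDerivAt I (b t * (N - I t - R t) * I t / (I t + ν * N) - g * I t) t)
    (hR : ∀ t ≥ (0:ℝ), ContinuousAt R t) (h0 : 0 ≤ I 0) : ∀ T ≥ (0:ℝ), 0 ≤ I T := by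
  intro T hT
  have hcont : ContinuousOn (fun t => N - I t - R t) (Set.Icc 0 T) := fun t ht =>
    ((continuousAt_const.sub (hI t ht.1).continuousAt).sub (hR t ht.1)).continuousWithinAt
  obtain ⟨C, hC⟩ := isCompact_Icc.exists_bound_of_continuousOn hcont
  have hC0 : 0 ≤ C := (norm_nonneg _).trans (hC 0 ⟨le_rfl, hT⟩)
  have hB0 : 0 ≤ B := (hb 0).trans (hB 0)
  have hνN : 0 < ν * N := mul_pos hν hN
  set K := B * C / (ν * N / 2) with hK
  have hK0 : 0 ≤ K := by positivity
  have key : ∀ η > 0, η * Real.exp (K * T) ≤ ν * N / 2 → - I T ≤ η * Real.exp (K * T) := by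
    intro η hη hs
    have hBd : ∀ t, HasDerivAt (fun s => η * Real.exp (K * s)) (η * (Real.exp (K * t) * (K * 1))) t :=
      fun t => (((hasDerivAt_id t).const_mul K).exp).const_mul η
    refine image_le_of_deriv_right_lt_deriv_boundary' (f := fun t => - I t)
      (f' := fun t => -(b t * (N - I t - R t) * I t / (I t + ν * N) - g * I t)) (a := 0) (b := T)
      (B := fun s => η * Real.exp (K * s)) (B' := fun t => η * (Real.exp (K * t) * (K * 1)))
      (fun t ht => (hI t ht.1).continuousAt.neg.continuousWithinAt)
      (fun t ht => (hI t ht.1).neg.hasDerivWithinAt) ?_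
      (fun t ht => (hBd t).continuousAt.continuousWithinAt)
      (fun t ht => (hBd t).hasDerivWithinAt) ?_ ⟨hT, le_rfl⟩
    · simp; linarith
    · intro t ht heq
      have hpos : 0 < η * Real.exp (K * t) := by positivity
      have hle : η * Real.exp (K * t) ≤ ν * N / 2 := by
        refine le_trans ?_ hs
        have := ht.2.le
        gcongr
      have hden : ν * N / 2 ≤ I t + ν * N := by linarith
      have h1 : b t * (N - I t - R t) ≤ B * C := by
        have h2 : N - I t - R t ≤ C := (le_abs_self _).trans (hC t ⟨ht.1, ht.2.le⟩)
        exact (mul_le_mul_of_nonneg_left h2 (hb t)).trans (mul_le_mul_of_nonneg_right (hB t) hC0)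
      have h2 : b t * (N - I t - R t) / (I t + ν * N) ≤ K := by
        rw [hK]
        exact div_le_div₀ (by positivity) h1 (by positivity) hden
      have e : b t * (N - I t - R t) * I t / (I t + ν * N)
        = b t * (N - I t - R t) / (I t + ν * N) * I t := by ring
      rw [e]
      have hIneg : I t = -(η * Real.exp (K * t)) := by linarith
      generalize b t * (N - I t - R t) / (I t + ν * N) = q at h2
      rw [hIneg]
      nlinarith [mul_pos hg hpos, mul_le_mul_of_nonneg_right h2 hpos.le]
  by_contra hneg
  push Not at hneg
  set E := Real.exp (K * T) with hE
  have hE0 : 0 < E := Real.exp_pos _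
  set m := min (-I T / 2) (ν * N / 2) with hm
  have hm0 : 0 < m := lt_min (by linarith) (by linarith)
  have e : m / E * E = m := div_mul_cancel₀ _ hE0.ne'
  have h1 := key (m / E) (by positivity) (by rw [e]; exact min_le_right _ _)
  rw [e] at h1
  have := min_le_left (-I T / 2) (ν * N / 2)
  linarith

/-- Local asymptotic stability of the trivial periodic solution `(0,0)` of the
nonautonomous IR system when `R₀ = α/((γ+μ)ν) < 1` and the first Floquet
exponent `α/ν + (δ/(νσ))∫₀^σ p − γ − μ` is negative. -/
theorem ir_trivial_periodic_solution_stable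
    (N ν α γ μ κ σ : ℝ) (hN : 0 < N) (hν : 0 < ν) (hα : 0 < α)
    (hγ : 0 < γ) (hμ : 0 < μ) (hκ : 0 < κ) (hσ : 0 < σ) (δ : ℝ)
    (p : ℝ → ℝ) (hp_cont : Continuous p) (hp_per : ∀ t, p (t + σ) = p t)
    (hβ_nonneg : ∀ t, 0 ≤ α + δ * p t)
    (hβ_bd : ∃ B, ∀ t, α + δ * p t ≤ B)
    (hR0 : α / ((γ + μ) * ν) < 1)
    (hFloquet : α / ν + δ / (ν * σ) * (∫ s in (0:ℝ)..σ, p s) - γ - μ < 0) :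
    ∃ ε > (0:ℝ), ∀ I R : ℝ → ℝ,
      (∀ t ≥ (0:ℝ), HasDerivAt I
        ((α + δ * p t) * (N - I t - R t) * I t / (I t + ν * N)
          - (γ + μ) * I t) t) →
      (∀ t ≥ (0:ℝ), HasDerivAt R (γ * I t - (μ + κ) * R t) t) →
      0 ≤ I 0 → 0 ≤ R 0 → I 0 + R 0 ≤ N →
      ‖((I 0, R 0) : ℝ × ℝ)‖ < ε →
      Filter.Tendsto (fun t => ((I t, R t) : ℝ × ℝ)) Filter.atTop
        (nhds ((0, 0) : ℝ × ℝ)) := by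
  obtain ⟨B, hB⟩ := hβ_bd
  refine ⟨1, one_pos, ?_⟩
  intro I R hI hR hI0 hR0' _ _
  have hIn : ∀ t ≥ (0:ℝ), 0 ≤ I t :=
    ir_I_nonneg N ν (γ + μ) hN hν (by linarith) (fun t => α + δ * p t) I R hβ_nonneg B hB hI
      (fun t ht => (hR t ht).continuousAt) hI0
  have hlin : ∀ (c t : ℝ), HasDerivAt (fun s : ℝ => -c * s) (-c) t := fun c t => by
    simpa using (hasDerivAt_id t).const_mul (-c)
  have hRn : ∀ t ≥ (0:ℝ), 0 ≤ R t := by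
    intro t ht
    have h := ir_compare (fun t => - R t) (fun t => -(γ * I t - (μ + κ) * R t))
      (fun s => -(μ + κ) * s) (fun _ => -(μ + κ)) 0 (fun t ht => (hR t ht).neg)
      (fun t _ => hlin _ t) (fun t ht => by nlinarith [mul_nonneg hγ.le (hIn t ht)]) t ht
    nlinarith [mul_nonneg hR0' (Real.exp_pos (-(μ + κ) * t - -(μ + κ) * 0)).le]
  let a : ℝ → ℝ := fun t => (γ + μ) - (α + δ * p t) / ν
  have ha : Continuous a := by fun_prop
  have haper : Function.Periodic a σ := fun t => by simp only [a, hp_per]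
  have hapos : 0 < ∫ x in (0:ℝ)..σ, a x := by
    have hpi : IntervalIntegrable p MeasureTheory.volume 0 σ := hp_cont.intervalIntegrable _ _
    have e : ∫ x in (0:ℝ)..σ, a x
        = -σ * (α / ν + δ / (ν * σ) * (∫ s in (0:ℝ)..σ, p s) - γ - μ) := by
      have e1 : ∀ x, a x = ((γ + μ) - α / ν) - (δ / ν) * p x := fun x => by simp only [a]; ring
      simp_rw [e1]
      rw [intervalIntegral.integral_sub (by simp) (hpi.const_mul _),
        intervalIntegral.integral_const, intervalIntegral.integral_const_mul]
      simp only [smul_eq_mul]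
      field_simp
      ring
    rw [e]
    nlinarith
  have hAt : Filter.Tendsto (fun t => ∫ x in (0:ℝ)..t, a x) Filter.atTop Filter.atTop :=
    haper.tendsto_atTop_intervalIntegral_of_pos hapos hσ
  have hIle : ∀ t ≥ (0:ℝ), I t ≤ I 0 * Real.exp (-(∫ x in (0:ℝ)..t, a x)) := by
    intro t ht
    have h := ir_compare I _ (fun t => -(∫ x in (0:ℝ)..t, a x)) (fun t => -a t) 0 hI
      (fun t _ => (ha.integral_hasStrictDerivAt 0 t).hasDerivAt.neg) (fun t ht => by
        have h1 := hIn t ht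
        have h2 := hRn t ht
        have hd : 0 < I t + ν * N := by positivity
        have h3 : (N - I t - R t) / (I t + ν * N) ≤ 1 / ν := by
          rw [div_le_div_iff₀ hd hν]
          nlinarith [mul_nonneg hν.le h1, mul_nonneg hν.le h2]
        have h4 := mul_le_mul_of_nonneg_left h3 (mul_nonneg (hβ_nonneg t) h1)
        have e : (α + δ * p t) * (N - I t - R t) * I t / (I t + ν * N)
          = (α + δ * p t) * I t * ((N - I t - R t) / (I t + ν * N)) := by ring
        have e2 : -a t * I t = (α + δ * p t) * I t * (1 / ν) - (γ + μ) * I t := by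
          simp only [a]; ring
        rw [e, e2]
        linarith) t ht
    simpa using h
  have hIt : Filter.Tendsto I Filter.atTop (nhds 0) := by
    have h1 : Filter.Tendsto (fun t => I 0 * Real.exp (-(∫ x in (0:ℝ)..t, a x)))
        Filter.atTop (nhds 0) := by
      simpa using (Real.tendsto_exp_neg_atTop_nhds_zero.comp hAt).const_mul (I 0)
    refine squeeze_zero' ?_ ?_ h1
    · filter_upwards [Filter.eventually_ge_atTop 0] with t ht using hIn t ht
    · filter_upwards [Filter.eventually_ge_atTop 0] with t ht using hIle t ht
  have hc : 0 < μ + κ := by linarith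
  have hRt : Filter.Tendsto R Filter.atTop (nhds 0) := by
    rw [Metric.tendsto_nhds]
    intro e he
    have hη : 0 < e / 2 := by linarith
    have hsm : ∀ᶠ t in Filter.atTop, I t < (μ + κ) * (e / 2) / γ :=
      hIt.eventually_lt_const (by positivity)
    obtain ⟨T, hT⟩ := Filter.eventually_atTop.1 (hsm.and (Filter.eventually_ge_atTop 0))
    have h := ir_compare (fun t => R t - e / 2) (fun t => γ * I t - (μ + κ) * R t)
      (fun s => -(μ + κ) * s) (fun _ => -(μ + κ)) T (fun t ht => (hR t (hT t ht).2).sub_const _)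
      (fun t _ => hlin _ t) (fun t ht => by
        have := (hT t ht).1
        rw [lt_div_iff₀ hγ] at this
        nlinarith)
    have h0 : Filter.Tendsto (fun t => (R T - e / 2) * Real.exp (-(μ + κ) * t - -(μ + κ) * T))
        Filter.atTop (nhds 0) := by
      have h1 : Filter.Tendsto (fun t => (μ + κ) * t + -(μ + κ) * T) Filter.atTop Filter.atTop :=
        Filter.tendsto_atTop_add_const_right _ _ (Filter.tendsto_id.const_mul_atTop hc)
      have h2 := (Real.tendsto_exp_neg_atTop_nhds_zero.comp h1).const_mul (R T - e / 2)
      rw [mul_zero] at h2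
      refine h2.congr fun t => ?_
      simp only [Function.comp]
      congr 2
      ring
    filter_upwards [h0.eventually_lt_const hη, Filter.eventually_ge_atTop T] with t h1 h2
    have h3 := h t h2
    have h4 := hRn t (hT t h2).2
    rw [Real.dist_eq, sub_zero, abs_of_nonneg h4]
    linarith
  exact hIt.prodMk_nhds hRt
end

section
/- Let N > 0 and ν > 0 be reals, and let φ₁ ≥ 0, φ₂ ≥ 0 be reals with φ₁ + φ₂ ≤ N and (φ₁, φ₂) ≠ (0,0). Then Φ := −ν·φ₁/(φ₁+νN) + ν(N−φ₁−φ₂)/(φ₁+νN)·(1 − φ₁/(φ₁+νN)) < 1, with equality Φ = 1 occurring exactly when (φ₁, φ₂) = (0,0). Consequently, for any nontrivial nonnegative σ-periodic solution φ of the IR model with φ₁(t)+φ₂(t) ≤ N, one has R_max := R₀·max_{0≤t≤σ} Φ(t) < R₀. -/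
theorem ir_aux_lt (N ν : ℝ) (hN : 0 < N) (hν : 0 < ν) (a b : ℝ) (ha : 0 ≤ a) (hb : 0 ≤ b)
    (hne : (a, b) ≠ (0, 0)) :
    -(ν * a) / (a + ν * N)
        + ν * (N - a - b) / (a + ν * N) * (1 - a / (a + ν * N)) < 1 := by
  have hνN : 0 < ν * N := mul_pos hν hN
  have hD : 0 < a + ν * N := by linarith
  have e : -(ν * a) / (a + ν * N)
        + ν * (N - a - b) / (a + ν * N) * (1 - a / (a + ν * N))
      = (-(ν * a) * (a + ν * N) + ν * (N - a - b) * (ν * N)) / (a + ν * N) ^ 2 := by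
    field_simp
    ring
  rw [e, div_lt_one (by positivity)]
  have h1 : 0 < a ∨ 0 < b := by
    by_contra h
    push Not at h
    exact hne (by rw [le_antisymm h.1 ha, le_antisymm h.2 hb])
  have h2 : 0 < a * (ν * N) + ν * (ν * N) * b := by
    rcases h1 with h | h <;> positivity
  have h3 : 0 ≤ ν * a * (a + ν * N) := by positivity
  have h4 : 0 ≤ ν * (ν * N) * a := by positivity
  have h5 : 0 ≤ a * (ν * N) := by positivity
  nlinarith [sq_nonneg a]

theorem ir_aux_zero (f f' : ℝ → ℝ) (c : ℝ) (hf : ∀ t, HasDerivAt f (f' t) t)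
    (hf' : ∀ t, 0 ≤ f' t + c * f t) (h0 : ∀ t, 0 ≤ f t) (t₀ : ℝ) (ht : f t₀ = 0)
    (s : ℝ) (hs : s ≤ t₀) : f s = 0 := by
  have hd : ∀ t, HasDerivAt (fun t => Real.exp (c * t) * f t)
      (Real.exp (c * t) * (f' t + c * f t)) t := by
    intro t
    have h1 : HasDerivAt (fun t => Real.exp (c * t)) (Real.exp (c * t) * (c * 1)) t :=
      ((hasDerivAt_id t).const_mul c).exp
    refine (h1.mul (hf t)).congr_deriv ?_
    ring
  have hm : Monotone (fun t => Real.exp (c * t) * f t) :=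
    monotone_of_hasDerivAt_nonneg hd
      (fun t => mul_nonneg (Real.exp_pos _).le (hf' t))
  have h := hm hs
  simp only [ht, mul_zero] at h
  have := Real.exp_pos (c * s)
  exact le_antisymm (nonpos_of_mul_nonpos_right h this) (h0 s)

/-- The quantity `Φ` appearing in the stability threshold satisfies `Φ < 1`
for every nonzero nonnegative state `(φ₁, φ₂)` with `φ₁ + φ₂ ≤ N`, with
equality `Φ = 1` exactly at `(0,0)`; consequently, for any nontrivial
nonnegative σ-periodic solution of the IR model one has `R_max < R₀`. -/
theorem ir_Phi_lt_one_and_Rmax_lt_R0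
    (N ν : ℝ) (hN : 0 < N) (hν : 0 < ν) :
    (∀ φ₁ φ₂ : ℝ, 0 ≤ φ₁ → 0 ≤ φ₂ → φ₁ + φ₂ ≤ N → (φ₁, φ₂) ≠ (0, 0) →
      -(ν * φ₁) / (φ₁ + ν * N)
        + ν * (N - φ₁ - φ₂) / (φ₁ + ν * N) * (1 - φ₁ / (φ₁ + ν * N)) < 1) ∧
    (∀ φ₁ φ₂ : ℝ, 0 ≤ φ₁ → 0 ≤ φ₂ → φ₁ + φ₂ ≤ N →
      (-(ν * φ₁) / (φ₁ + ν * N)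
        + ν * (N - φ₁ - φ₂) / (φ₁ + ν * N) * (1 - φ₁ / (φ₁ + ν * N)) = 1 ↔
        (φ₁, φ₂) = ((0 : ℝ), (0 : ℝ)))) ∧
    (∀ α γ μ κ σ δ : ℝ, 0 < α → 0 < γ → 0 < μ → 0 < κ → 0 < σ →
      ∀ p : ℝ → ℝ, Continuous p → (∀ t, p (t + σ) = p t) →
      (∀ t, 0 ≤ α + δ * p t) →
      ∀ φ₁ φ₂ : ℝ → ℝ,
        (∀ t, HasDerivAt φ₁
          ((α + δ * p t) * (N - φ₁ t - φ₂ t) * φ₁ t / (φ₁ t + ν * N)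
            - (γ + μ) * φ₁ t) t) →
        (∀ t, HasDerivAt φ₂ (γ * φ₁ t - (μ + κ) * φ₂ t) t) →
        (∀ t, φ₁ (t + σ) = φ₁ t ∧ φ₂ (t + σ) = φ₂ t) →
        (¬ ∀ t, φ₁ t = 0 ∧ φ₂ t = 0) →
        (∀ t, 0 ≤ φ₁ t ∧ 0 ≤ φ₂ t ∧ φ₁ t + φ₂ t ≤ N) →
        α / ((γ + μ) * ν) *
          sSup ((fun t => -(ν * φ₁ t) / (φ₁ t + ν * N)
            + ν * (N - φ₁ t - φ₂ t) / (φ₁ t + ν * N)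
              * (1 - φ₁ t / (φ₁ t + ν * N))) '' Set.Icc 0 σ)
          < α / ((γ + μ) * ν)) := by
  refine ⟨fun a b ha hb _ hne => ir_aux_lt N ν hN hν a b ha hb hne, ?_, ?_⟩
  · intro a b ha hb _
    constructor
    · intro h
      by_contra hne
      exact (ir_aux_lt N ν hN hν a b ha hb hne).ne h
    · intro h
      obtain ⟨rfl, rfl⟩ := Prod.mk.inj h
      field_simp
      simp
      ring
  · intro α γ μ κ σ δ hα hγ hμ hκ hσ p _ _ hβ φ₁ φ₂ h1 h2 hper hnt hnn
    have hνN : 0 < ν * N := mul_pos hν hN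
    have hD : ∀ t, 0 < φ₁ t + ν * N := fun t => by linarith [(hnn t).1]
    have hne : ∀ t, (φ₁ t, φ₂ t) ≠ (0, 0) := by
      intro t₀ h
      obtain ⟨ha, hb⟩ := Prod.mk.inj h
      apply hnt
      intro t
      obtain ⟨n, hn⟩ := exists_nat_ge ((t - t₀) / σ)
      have hs : t - n * σ ≤ t₀ := by
        rw [div_le_iff₀ hσ] at hn
        linarith
      have e1 := Function.Periodic.sub_nat_mul_eq (f := φ₁) (c := σ) (x := t)
        (fun t => (hper t).1) n
      have e2 := Function.Periodic.sub_nat_mul_eq (f := φ₂) (c := σ) (x := t)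
        (fun t => (hper t).2) n
      rw [← e1, ← e2]
      constructor
      · refine ir_aux_zero φ₁ _ (γ + μ) h1 ?_ (fun t => (hnn t).1) t₀ ha _ hs
        intro t
        have : 0 ≤ (α + δ * p t) * (N - φ₁ t - φ₂ t) * φ₁ t / (φ₁ t + ν * N) :=
          div_nonneg (mul_nonneg (mul_nonneg (hβ t) (by linarith [(hnn t).2.2])) (hnn t).1)
            (hD t).le
        linarith
      · refine ir_aux_zero φ₂ _ (μ + κ) h2 ?_ (fun t => (hnn t).2.1) t₀ hb _ hs
        intro t
        have : 0 ≤ γ * φ₁ t := mul_nonneg hγ.le (hnn t).1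
        linarith
    have c1 : Continuous φ₁ := continuous_iff_continuousAt.2 fun t => (h1 t).continuousAt
    have c2 : Continuous φ₂ := continuous_iff_continuousAt.2 fun t => (h2 t).continuousAt
    have hD' : ∀ t, φ₁ t + ν * N ≠ 0 := fun t => (hD t).ne'
    have hc : Continuous (fun t => -(ν * φ₁ t) / (φ₁ t + ν * N)
            + ν * (N - φ₁ t - φ₂ t) / (φ₁ t + ν * N)
              * (1 - φ₁ t / (φ₁ t + ν * N))) := by
      fun_prop (disch := assumption)
    have hmem := (isCompact_Icc.image hc).sSup_mem
      ((Set.nonempty_Icc.2 hσ.le).image _)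
    obtain ⟨t, _, ht⟩ := hmem
    rw [← ht]
    have hR : 0 < α / ((γ + μ) * ν) := by positivity
    exact mul_lt_of_lt_one_right hR
      (ir_aux_lt N ν hN hν _ _ (hnn t).1 (hnn t).2.1 (hne t))
end

section
/- Let N, ν, γ, μ, κ > 0, let β : ℝ → ℝ be continuous and nonnegative, and let (I,R) : [0,∞) → ℝ² be a solution of the IR system İ = β(t)(N−I−R)·I/(I+νN) − (γ+μ)I, Ṙ = γI − (μ+κ)R with I(0) ≥ 0 and R(0) ≥ 0. Then I(t) ≥ 0 and R(t) ≥ 0 for all t ≥ 0; that is, the nonnegative orthant is positively invariant for the IR system. -/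
/-- Positive invariance of the nonnegative orthant for the nonautonomous IR
system: solutions starting with `I(0) ≥ 0` and `R(0) ≥ 0` stay nonnegative. -/
theorem ir_nonneg_orthant_invariant
    (N ν γ μ κ : ℝ) (hN : 0 < N) (hν : 0 < ν)
    (hγ : 0 < γ) (hμ : 0 < μ) (hκ : 0 < κ)
    (β : ℝ → ℝ) (hβ_cont : Continuous β) (hβ_nonneg : ∀ t, 0 ≤ β t)
    (I R : ℝ → ℝ)
    (hI : ∀ t ≥ (0:ℝ), HasDerivAt I
      (β t * (N - I t - R t) * I t / (I t + ν * N) - (γ + μ) * I t) t)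
    (hR : ∀ t ≥ (0:ℝ), HasDerivAt R (γ * I t - (μ + κ) * R t) t)
    (hI0 : 0 ≤ I 0) (hR0 : 0 ≤ R 0) :
    ∀ t ≥ (0:ℝ), 0 ≤ I t ∧ 0 ≤ R t := by
  have hIc : ∀ T, ContinuousOn I (Set.Icc 0 T) := fun T t ht =>
    (hI t ht.1).continuousAt.continuousWithinAt
  have hRc : ∀ T, ContinuousOn R (Set.Icc 0 T) := fun T t ht =>
    (hR t ht.1).continuousAt.continuousWithinAt
  have hνN : 0 < ν * N := mul_pos hν hN
  have hIn : ∀ t ≥ (0:ℝ), 0 ≤ I t := by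
    intro T hT
    have hc : ContinuousOn (fun t => β t * (N - I t - R t)) (Set.Icc 0 T) :=
      hβ_cont.continuousOn.mul ((continuousOn_const.sub (hIc T)).sub (hRc T))
    obtain ⟨C, hC⟩ := isCompact_Icc.exists_bound_of_continuousOn hc
    have hC0 : 0 ≤ C := le_trans (norm_nonneg _) (hC 0 ⟨le_refl _, hT⟩)
    set K : ℝ := C / (ν * N / 2) with hK
    have hK0 : 0 ≤ K := by positivity
    have key : ∀ δ > 0, δ ≤ ν * N / 2 → -I T ≤ δ := by
      intro δ hδ hδ2
      have hB : ∀ x : ℝ, HasDerivAt (fun t => δ * Real.exp (K * (t - T)))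
          (δ * (Real.exp (K * (x - T)) * (K * 1))) x := fun x =>
        ((((hasDerivAt_id x).sub_const T).const_mul K).exp).const_mul δ
      have := image_le_of_deriv_right_lt_deriv_boundary (f := fun t => -I t)
        (f' := fun t => -(β t * (N - I t - R t) * I t / (I t + ν * N) - (γ + μ) * I t))
        (hIc T).neg (fun x hx => (hI x hx.1).neg.hasDerivWithinAt)
        (show -I 0 ≤ δ * Real.exp (K * (0 - T)) by
          have : 0 < δ * Real.exp (K * (0 - T)) := by positivity
          linarith) hB ?_ (Set.right_mem_Icc.2 hT)
      · simpa using this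
      · intro x hx hxe
        have hle : Real.exp (K * (x - T)) ≤ 1 := by
          rw [Real.exp_le_one_iff]
          exact mul_nonpos_of_nonneg_of_nonpos hK0 (by linarith [hx.2])
        have hp : 0 < δ * Real.exp (K * (x - T)) := by positivity
        have hb : δ * Real.exp (K * (x - T)) ≤ ν * N / 2 := by nlinarith
        have hd : ν * N / 2 ≤ I x + ν * N := by
          linarith
        have ha : β x * (N - I x - R x) / (I x + ν * N) ≤ K := by
          have h1 := (le_abs_self _).trans (hC x ⟨hx.1, hx.2.le⟩)
          exact div_le_div₀ hC0 h1 (by positivity) hd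
        have e1 : δ * (Real.exp (K * (x - T)) * (K * 1)) = K * (-I x) := by rw [hxe]; ring
        rw [e1, mul_div_right_comm]
        rw [← hxe] at hp
        nlinarith [mul_le_mul_of_nonneg_right ha hp.le, mul_pos (add_pos hγ hμ) hp]
    by_contra! h
    have := key (min (-I T / 2) (ν * N / 2)) (lt_min (by linarith) (by linarith)) (min_le_right _ _)
    linarith [min_le_left (-I T / 2) (ν * N / 2)]
  intro T hT
  refine ⟨hIn T hT, ?_⟩
  have key : ∀ δ > 0, -R T ≤ δ := by
    intro δ hδ
    refine image_le_of_deriv_right_lt_deriv_boundary (f := fun t => -R t)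
        (f' := fun t => -(γ * I t - (μ + κ) * R t)) (B := fun _ => δ) (B' := fun _ => 0)
        (hRc T).neg (fun x hx => (hR x hx.1).neg.hasDerivWithinAt)
        (show -R 0 ≤ δ by linarith) (fun x => hasDerivAt_const x δ) ?_ (Set.right_mem_Icc.2 hT)
    intro x hx hxe
    have e : R x = -δ := by linarith
    rw [e]
    nlinarith [mul_nonneg hγ.le (hIn x hx.1), mul_pos (add_pos hμ hκ) hδ]
  by_contra! h
  linarith [key (-R T / 2) (by linarith)]
end
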